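/- There exists a nonnegative function φ ∈ L¹(ℝ) with integrable nonnegative Fourier transform such that the zero set {ξ ∈ ℝ : 𝓕φ(ξ) = 0} of its Fourier transform has positive Lebesgue measure while its complement is dense in ℝ. -/

import Mathlib

open MeasureTheory Complex
open scoped FourierTransform

/-- The sum of a series of nonnegative integrable functions with summable integrals is
integrable. -/
theorem integrable_tsum_of_nonneg {α : Type*} [MeasurableSpace α] {μ : Measure α}
    {F : ℕ → α → ℝ} (h0 : ∀ n x, 0 ≤ F n x) (hF : ∀ n, Integrable (F n) μ)
    (hs : Summable fun n => ∫ x, F n x ∂μ) : Integrable (fun x => ∑' n, F n x) μ := by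
  have key : Integrable (fun x => (∑' n, ENNReal.ofReal (F n x)).toReal) μ := by
    have hm : ∀ n, AEMeasurable (fun x => ENNReal.ofReal (F n x)) μ :=
      fun n => (hF n).aestronglyMeasurable.aemeasurable.ennreal_ofReal
    refine integrable_toReal_of_lintegral_ne_top (AEMeasurable.tsum hm) ?_
    rw [lintegral_tsum hm]
    have : ∀ n, ∫⁻ x, ENNReal.ofReal (F n x) ∂μ = ENNReal.ofReal (∫ x, F n x ∂μ) := fun n =>
      (ofReal_integral_eq_lintegral_ofReal (hF n) (.of_forall (h0 n))).symm
    simp_rw [this]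
    exact hs.tsum_ofReal_ne_top
  refine key.congr (.of_forall fun x => ?_)
  dsimp only
  rw [ENNReal.tsum_toReal_eq fun n => ENNReal.ofReal_ne_top]
  exact tsum_congr fun n => ENNReal.toReal_ofReal (h0 n x)

/-- The Fourier transform of an even real function is real. -/
theorem fourier_ofReal_im_eq_zero_of_even {u : ℝ → ℝ} (hu : ∀ x, u (-x) = u x) (ξ : ℝ) :
    (𝓕 (fun x : ℝ => (u x : ℂ)) ξ).im = 0 := by
  rw [← Complex.conj_eq_iff_im, Real.fourier_real_eq_integral_exp_smul, ← integral_conj,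
    ← integral_neg_eq_self]
  refine integral_congr_ae (.of_forall fun x => ?_)
  simp [← Complex.exp_conj, hu, Complex.conj_ofNat]

/-- A nonnegative integrable function with nonnegative compactly supported Fourier transform. -/
theorem exists_nonneg_fourier_compactly_supported :
    ∃ ψ h : ℝ → ℝ, (∀ t, 0 ≤ ψ t) ∧ Integrable ψ ∧ (∀ ξ, 0 ≤ h ξ) ∧ Integrable h ∧
      (∀ ξ, 𝓕 (fun t : ℝ => (ψ t : ℂ)) ξ = h ξ) ∧ 0 < h 0 ∧ ∀ ξ, 1 ≤ |ξ| → h ξ = 0 := by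
  let b : ContDiffBump (0 : ℝ) := ⟨1 / 4, 1 / 2, by norm_num, by norm_num⟩
  have hbc : HasCompactSupport (fun x : ℝ => (b x : ℂ)) :=
    b.hasCompactSupport.comp_left (g := fun x : ℝ => (x : ℂ)) Complex.ofReal_zero
  let u : SchwartzMap ℝ ℂ := hbc.toSchwartzMap (Complex.ofRealCLM.contDiff.comp b.contDiff)
  have hu : ∀ x, u x = b x := fun x => rfl
  let W : SchwartzMap ℝ ℂ := SchwartzMap.convolution (ContinuousLinearMap.mul ℂ ℂ) u u
  let h : ℝ → ℝ := fun x => ∫ t, b t * b (x - t)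
  have hW : ∀ x, W x = h x := fun x => by
    simp only [W, h, SchwartzMap.convolution_apply, convolution_def, hu,
      ContinuousLinearMap.mul_apply', ← Complex.ofReal_mul]
    exact integral_ofReal
  have hWF : ∀ x, (𝓕⁻ W) x = (((𝓕 u (-x)).re ^ 2 : ℝ) : ℂ) := fun x => by
    have h1 : (𝓕⁻ W) x = (𝓕 W) (-x) := by
      rw [SchwartzMap.fourierInv_coe, SchwartzMap.fourier_coe, Real.fourierInv_eq_fourier_neg]
    have h2 : (𝓕 W) (-x) = 𝓕 u (-x) * 𝓕 u (-x) := by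
      simp [W, SchwartzMap.fourier_convolution]
    have h3 : (𝓕 u (-x)).im = 0 := by
      rw [SchwartzMap.fourier_coe]
      exact fourier_ofReal_im_eq_zero_of_even (fun y => b.neg y) _
    rw [h1, h2]
    apply Complex.ext <;> simp [h3, pow_two]
  have hb0 : ∀ x t, 0 ≤ b t * b (x - t) := fun x t => mul_nonneg b.nonneg b.nonneg
  refine ⟨fun t => (𝓕 u (-t)).re ^ 2, h, fun t => sq_nonneg _, ?_,
    fun ξ => integral_nonneg (hb0 ξ), ?_, fun ξ => ?_, ?_, fun ξ hξ => ?_⟩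
  · refine (𝓕⁻ W).integrable.re.congr (.of_forall fun x => ?_)
    simp only [hWF]
    exact Complex.ofReal_re _
  · refine W.integrable.re.congr (.of_forall fun x => ?_)
    simp [hW]
  · simp_rw [← hWF, ← hW]
    rw [← SchwartzMap.fourier_coe, FourierTransform.fourier_fourierInv_eq]
  · have hc : Continuous fun t => b t * b (0 - t) := by
      have := b.continuous
      fun_prop
    refine hc.integral_pos_of_hasCompactSupport_nonneg_nonzero
      b.hasCompactSupport.mul_right (hb0 0) (x := 0) ?_
    have : b 0 = 1 := b.one_of_mem_closedBall (by simp [b])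
    simp [this]
  · have : ∀ t, b t * b (ξ - t) = 0 := fun t => by
      rcases le_or_gt (1 / 2) |t| with ht | ht
      · rw [b.zero_of_le_dist (by simpa [b, Real.dist_eq] using ht), zero_mul]
      · rw [b.zero_of_le_dist (x := ξ - t), mul_zero]
        have := abs_sub_abs_le_abs_sub ξ t
        simp only [b, Real.dist_eq, sub_zero]
        linarith
    simp [h, this]

/-- Fourier transform of a modulated function. -/
theorem fourier_one_add_cos_mul {ψ h : ℝ → ℝ} (hψ : Integrable ψ)
    (hF : ∀ ξ, 𝓕 (fun t : ℝ => (ψ t : ℂ)) ξ = h ξ) (a ξ : ℝ) :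
    𝓕 (fun t : ℝ => (((1 + Real.cos (2 * Real.pi * a * t)) * ψ t : ℝ) : ℂ)) ξ =
      ((h ξ + (h (ξ - a) + h (ξ + a)) / 2 : ℝ) : ℂ) := by
  have hI : ∀ η : ℝ,
      Integrable fun t : ℝ => Complex.exp (↑(-2 * Real.pi * t * η) * I) • (ψ t : ℂ) := fun η => by
    refine hψ.ofReal.bdd_mul (c := 1) (by fun_prop) (.of_forall fun t => ?_)
    rw [Complex.norm_exp_ofReal_mul_I]
  push_cast
  simp_rw [← hF, Real.fourier_real_eq_integral_exp_smul]
  rw [← integral_add (hI _) (hI _), ← integral_div,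
    ← integral_add (hI _) (by exact ((hI _).add (hI _)).div_const 2)]
  refine integral_congr_ae (.of_forall fun t => ?_)
  simp only [smul_eq_mul, Complex.cos]
  have h1 : Complex.exp (↑(-2 * Real.pi * t * (ξ - a)) * I) =
      Complex.exp (↑(-2 * Real.pi * t * ξ) * I) * Complex.exp (2 * Real.pi * a * t * I) := by
    rw [← Complex.exp_add]; congr 1; push_cast; ring
  have h2 : Complex.exp (↑(-2 * Real.pi * t * (ξ + a)) * I) =
      Complex.exp (↑(-2 * Real.pi * t * ξ) * I) * Complex.exp (-(2 * Real.pi * a * t) * I) := by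
    rw [← Complex.exp_add]; congr 1; push_cast; ring
  rw [h1, h2]
  ring

/-- Fourier transform of a dilated function. -/
theorem fourier_dilation {ψ h : ℝ → ℝ} (hF : ∀ ξ, 𝓕 (fun t : ℝ => (ψ t : ℂ)) ξ = h ξ)
    {w : ℝ} (hw : 0 < w) (c ξ : ℝ) :
    𝓕 (fun t : ℝ => ((c * ψ (w * t) : ℝ) : ℂ)) ξ = ((c / w * h (ξ / w) : ℝ) : ℂ) := by
  push_cast
  rw [← hF, Real.fourier_real_eq_integral_exp_smul, Real.fourier_real_eq_integral_exp_smul]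
  have := Measure.integral_comp_mul_left
    (fun t : ℝ => Complex.exp (↑(-2 * Real.pi * t * (ξ / w)) * I) • (ψ t : ℂ)) w
  rw [abs_of_pos (inv_pos.2 hw)] at this
  rw [div_mul_eq_mul_div, mul_div_assoc, div_eq_inv_mul (integral _ _), ← Complex.ofReal_inv,
    ← Complex.real_smul (x := w⁻¹), ← this, ← integral_const_mul]
  refine integral_congr_ae (.of_forall fun t => ?_)
  have h1 : -2 * Real.pi * (w * t) * (ξ / w) = -2 * Real.pi * t * ξ := by field_simp
  simp only [h1, smul_eq_mul]
  ring

/-- A nonnegative integrable function of small integral whose Fourier transform is nonnegative,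
has small integral and small support, and is positive at a given point. -/
theorem exists_nonneg_fourier_small_support (a : ℝ) {ε : ℝ} (hε : 0 < ε) :
    ∃ ψ h : ℝ → ℝ, (∀ t, 0 ≤ ψ t) ∧ Integrable ψ ∧ (∀ ξ, 0 ≤ h ξ) ∧ Integrable h ∧
      (∀ ξ, 𝓕 (fun t : ℝ => (ψ t : ℂ)) ξ = h ξ) ∧ 0 < h a ∧ ∫ t, ψ t ≤ ε ∧ ∫ ξ, h ξ ≤ ε ∧
      volume (Function.support h) ≤ ENNReal.ofReal ε := by
  obtain ⟨ψ, h, hψ0, hψi, hh0, hhi, hF, hpos, hsupp⟩ := exists_nonneg_fourier_compactly_supported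
  set w := ε / 6 with hwdef
  have hw : 0 < w := by positivity
  have hk0 : ∀ ξ, 0 ≤ h (ξ / w) := fun ξ => hh0 _
  have hki : Integrable fun ξ => h (ξ / w) := hhi.comp_div hw.ne'
  set ψ₁ : ℝ → ℝ := fun t => (1 + Real.cos (2 * Real.pi * a * t)) * ψ (w * t)
  set h₁ : ℝ → ℝ := fun ξ => 1 / w * h (ξ / w) +
    (1 / w * h ((ξ - a) / w) + 1 / w * h ((ξ + a) / w)) / 2 with hh₁
  have hψw : Integrable fun t => ψ (w * t) := hψi.comp_mul_left' hw.ne'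
  have hψ₁0 : ∀ t, 0 ≤ ψ₁ t := fun t =>
    mul_nonneg (by linarith [Real.neg_one_le_cos (2 * Real.pi * a * t)]) (hψ0 _)
  have hψ₁i : Integrable ψ₁ := by
    refine hψw.bdd_mul (c := 2) (by fun_prop) (.of_forall fun t => ?_)
    rw [Real.norm_eq_abs, abs_le]
    constructor <;> linarith [Real.neg_one_le_cos (2 * Real.pi * a * t),
      Real.cos_le_one (2 * Real.pi * a * t)]
  have hh₁0 : ∀ ξ, 0 ≤ h₁ ξ := fun ξ => by
    have := hh0 (ξ / w); have := hh0 ((ξ - a) / w); have := hh0 ((ξ + a) / w)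
    positivity
  have hh₁i : Integrable h₁ := by
    have hki' := hki.const_mul (1 / w)
    exact hki'.add (((hki'.comp_sub_right a).add (hki'.comp_add_right a)).div_const 2)
  have hF₁ : ∀ ξ, 𝓕 (fun t : ℝ => (ψ₁ t : ℂ)) ξ = h₁ ξ := fun ξ =>
    fourier_one_add_cos_mul hψw
      (h := fun ξ => 1 / w * h (ξ / w)) (fun η => by simpa using fourier_dilation hF hw 1 η) a ξ
  have hIψ : 0 ≤ ∫ t, ψ₁ t := integral_nonneg hψ₁0
  have hIh : 0 ≤ ∫ t, h₁ t := integral_nonneg hh₁0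
  set D := 1 + (∫ t, ψ₁ t) + ∫ t, h₁ t
  have hDpos : 0 < D := by positivity
  have hc : 0 < ε / D := by positivity
  have hh₁a : 0 < h₁ a := by
    have := hh0 (a / w); have := hh0 ((a + a) / w)
    simp only [hh₁, sub_self, zero_div]
    positivity
  refine ⟨fun t => ε / D * ψ₁ t, fun ξ => ε / D * h₁ ξ, fun t => mul_nonneg hc.le (hψ₁0 t),
    hψ₁i.const_mul _, fun t => mul_nonneg hc.le (hh₁0 t), hh₁i.const_mul _, fun ξ => ?_,
    mul_pos hc hh₁a, ?_, ?_, ?_⟩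
  · simpa using fourier_dilation hF₁ one_pos (ε / D) ξ
  · rw [integral_const_mul, div_mul_eq_mul_div, div_le_iff₀ hDpos]
    gcongr; linarith
  · rw [integral_const_mul, div_mul_eq_mul_div, div_le_iff₀ hDpos]
    gcongr; linarith
  · have hz : ∀ x, w ≤ |x| → h (x / w) = 0 := fun x hx => hsupp _ <| by
      rwa [abs_div, abs_of_pos hw, one_le_div hw]
    have hsub : Function.support (fun ξ => ε / D * h₁ ξ) ⊆
        Metric.ball 0 w ∪ (Metric.ball a w ∪ Metric.ball (-a) w) := by
      intro ξ hξ
      by_contra hcon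
      simp only [Set.mem_union, Metric.mem_ball, Real.dist_eq, not_or, not_lt, sub_zero,
        sub_neg_eq_add] at hcon
      apply hξ
      simp [hh₁, hz _ hcon.1, hz _ hcon.2.1, hz _ hcon.2.2]
    refine (measure_mono hsub).trans <| (measure_union_le _ _).trans <|
      (add_le_add_right (measure_union_le _ _) _).trans ?_
    simp only [Real.volume_ball]
    rw [← ENNReal.ofReal_add (by positivity) (by positivity),
      ← ENNReal.ofReal_add (by positivity) (by positivity)]
    apply ENNReal.ofReal_le_ofReal
    rw [hwdef]; linarith

/-- there is a nonnegative `φ ∈ L¹(ℝ)` whose Fourier transform is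
nonnegative and integrable, and whose zero set has positive Lebesgue measure while its
complement is dense in `ℝ`. -/
theorem exists_nonneg_L1_fourier_zero_set_positive_measure_dense_complement :
    ∃ φ : ℝ → ℝ, (∀ t, 0 ≤ φ t) ∧ Integrable φ volume ∧
      (∃ g : ℝ → ℝ, (∀ ξ, 0 ≤ g ξ) ∧ Integrable g volume ∧
        ∀ ξ : ℝ, 𝓕 (fun t : ℝ => (φ t : ℂ)) ξ = (g ξ : ℂ)) ∧
      0 < volume {ξ : ℝ | 𝓕 (fun t : ℝ => (φ t : ℂ)) ξ = 0} ∧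
      Dense {ξ : ℝ | 𝓕 (fun t : ℝ => (φ t : ℂ)) ξ = 0}ᶜ := by
  have hε : ∀ n : ℕ, (0 : ℝ) < (1 / 2) ^ n := fun n => by positivity
  choose ψ h hψ0 hψi hh0 hhi hF hpos hIψ hIh hvol using fun n : ℕ =>
    exists_nonneg_fourier_small_support (TopologicalSpace.denseSeq ℝ n) (hε n)
  have hsε : Summable fun n : ℕ => ((1 / 2 : ℝ)) ^ n := summable_geometric_two
  have hsψ : Summable fun n => ∫ t, ψ n t :=
    hsε.of_nonneg_of_le (fun n => integral_nonneg (hψ0 n)) hIψ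
  have hsh : Summable fun n => ∫ t, h n t :=
    hsε.of_nonneg_of_le (fun n => integral_nonneg (hh0 n)) hIh
  have hsum : ∀ ξ : ℝ, HasSum (fun n => (h n ξ : ℂ))
      (𝓕 (fun t : ℝ => ((∑' n, ψ n t : ℝ) : ℂ)) ξ) := fun ξ => by
    simp_rw [← hF, Real.fourier_real_eq_integral_exp_smul, Complex.ofReal_tsum,
      smul_eq_mul, ← tsum_mul_left]
    have hn : ∀ n t, ‖Complex.exp (↑(-2 * Real.pi * t * ξ) * I) * (ψ n t : ℂ)‖ = ψ n t :=
      fun n t => by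
        rw [norm_mul, Complex.norm_exp_ofReal_mul_I, one_mul, Complex.norm_real,
          Real.norm_of_nonneg (hψ0 n t)]
    refine hasSum_integral_of_summable_integral_norm (fun n => ?_) (by simpa only [hn] using hsψ)
    refine (hψi n).ofReal.bdd_mul (c := 1) (by fun_prop) (.of_forall fun t => ?_)
    rw [Complex.norm_exp_ofReal_mul_I]
  have hFt : ∀ ξ : ℝ, 𝓕 (fun t : ℝ => ((∑' n, ψ n t : ℝ) : ℂ)) ξ = ((∑' n, h n ξ : ℝ) : ℂ) :=
    fun ξ => by rw [Complex.ofReal_tsum, (hsum ξ).tsum_eq]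
  refine ⟨fun t => ∑' n, ψ n t, fun t => tsum_nonneg fun n => hψ0 n t,
    integrable_tsum_of_nonneg hψ0 hψi hsψ, ⟨fun ξ => ∑' n, h n ξ,
      fun ξ => tsum_nonneg fun n => hh0 n ξ, integrable_tsum_of_nonneg hh0 hhi hsh, hFt⟩, ?_, ?_⟩
  · rw [pos_iff_ne_zero]
    intro hzero
    have hsup : volume (⋃ n, Function.support (h n)) < ⊤ := by
      refine ((measure_iUnion_le _).trans (ENNReal.tsum_le_tsum hvol)).trans_lt ?_
      exact hsε.tsum_ofReal_lt_top
    have hcov : (Set.univ : Set ℝ) ⊆ (⋃ n, Function.support (h n)) ∪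
        {ξ : ℝ | 𝓕 (fun t : ℝ => ((∑' n, ψ n t : ℝ) : ℂ)) ξ = 0} := by
      intro ξ _
      by_cases hξ : ξ ∈ ⋃ n, Function.support (h n)
      · exact .inl hξ
      · have : ∀ n, h n ξ = 0 := by simpa using hξ
        right
        simp only [Set.mem_ofPred_eq, hFt, this, tsum_zero, Complex.ofReal_zero]
    have := (measure_mono (μ := volume) hcov).trans (measure_union_le _ _)
    rw [hzero, add_zero, Real.volume_univ] at this
    exact this.not_gt hsup
  · refine (TopologicalSpace.denseRange_denseSeq ℝ).mono ?_
    rintro _ ⟨n, rfl⟩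
    have hs : Summable fun m => h m (TopologicalSpace.denseSeq ℝ n) :=
      Complex.summable_ofReal.1 (hsum _).summable
    have := hs.tsum_pos (fun m => hh0 m _) n (hpos n)
    simp only [Set.mem_compl_iff, Set.mem_ofPred_eq, hFt, Complex.ofReal_eq_zero]
    exact this.ne'
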